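/- Let R ⊆ E be an extension of Rota-Baxter family Hom-associative algebras of weight λ, ρ : E → R a linear retraction, V := ker ρ, and Ω(R,V) := Υ₁(E) the associated Rota-Baxter family Hom extending structure. Suppose B is a Rota-Baxter family Hom complement of R in E, let d̃ : E → R be the retraction associated to B (d̃(a + b) = a for a ∈ R, b ∈ B), and set d := −d̃|_V : V → R. Then d is a deformation map of Ω(R,V), and the map φ : V_d → B, φ(x) := x + d(x), is an isomorphism of Rota-Baxter family Hom-associative algebras; in particular B ≅ V_d. -/

import Mathlib

/-- The data of a Rota-Baxter family Hom-associative algebra: a bilinear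
multiplication, a family of linear operators indexed by a semigroup `S`,
and a linear twisting map. -/
structure RBFData (k S R : Type*) [Field k] [Semigroup S]
    [AddCommGroup R] [Module k R] where
  mul : R →ₗ[k] R →ₗ[k] R
  P : S → R →ₗ[k] R
  theta : R →ₗ[k] R

/-- The axioms of a Rota-Baxter family Hom-associative algebra of weight `lam`,
stated for arbitrary operations. -/
def IsRBFOps {k S M : Type*} [Field k] [Semigroup S] [AddCommGroup M] [Module k M]
    (lam : k) (mul : M → M → M) (P : S → M → M) (theta : M → M) : Prop :=
  (∀ x y z : M, mul (theta x) (mul y z) = mul (mul x y) (theta z)) ∧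
  (∀ (α β : S) (x y : M), mul (P α x) (P β y)
      = P (α * β) (mul (P α x) y + mul x (P β y) + lam • mul x y)) ∧
  (∀ (ω : S) (x : M), P ω (theta x) = theta (P ω x))

/-- `(R, ·, (P_ω), θ)` is a Rota-Baxter family Hom-associative algebra of weight `lam`. -/
def RBFData.IsRBF {k S R : Type*} [Field k] [Semigroup S] [AddCommGroup R] [Module k R]
    (A : RBFData k S R) (lam : k) : Prop :=
  IsRBFOps lam (fun x y => A.mul x y) (fun ω x => A.P ω x) (fun x => A.theta x)

/-- An extending datum `Ω(R,V)` of `R` through `V`: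
`dR` is `▷ : R×V→V`, `dL` is `◁ : V×R→V`, `hR` is `⇀ : V×R→R`, `hL` is `↼ : R×V→R`,
`f : V×V→R` is the cocycle, `mulV : V×V→V`, and the linear maps
`Q_ω : V→R`, `PV_ω : V→V`, `eta : V→R`, `thetaV : V→V`. -/
structure ExtDatum (k S R V : Type*) [Field k] [Semigroup S]
    [AddCommGroup R] [Module k R] [AddCommGroup V] [Module k V] where
  dR : R →ₗ[k] V →ₗ[k] V
  dL : V →ₗ[k] R →ₗ[k] V
  hR : V →ₗ[k] R →ₗ[k] R
  hL : R →ₗ[k] V →ₗ[k] R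
  f : V →ₗ[k] V →ₗ[k] R
  mulV : V →ₗ[k] V →ₗ[k] V
  Q : S → V →ₗ[k] R
  PV : S → V →ₗ[k] V
  eta : V →ₗ[k] R
  thetaV : V →ₗ[k] V

/-- The multiplication of the (prospective) unified product `R ♮ V`. -/
def natMul {k S R V : Type*} [Field k] [Semigroup S]
    [AddCommGroup R] [Module k R] [AddCommGroup V] [Module k V]
    (A : RBFData k S R) (D : ExtDatum k S R V) : R × V → R × V → R × V := fun p q =>
  (A.mul p.1 q.1 + D.hL p.1 q.2 + D.hR p.2 q.1 + D.f p.2 q.2,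
   D.dR p.1 q.2 + D.dL p.2 q.1 + D.mulV p.2 q.2)

/-- The Rota-Baxter family of the (prospective) unified product `R ♮ V`. -/
def natP {k S R V : Type*} [Field k] [Semigroup S]
    [AddCommGroup R] [Module k R] [AddCommGroup V] [Module k V]
    (A : RBFData k S R) (D : ExtDatum k S R V) : S → R × V → R × V := fun ω p =>
  (A.P ω p.1 + D.Q ω p.2, D.PV ω p.2)

/-- The twisting map of the (prospective) unified product `R ♮ V`. -/
def natTheta {k S R V : Type*} [Field k] [Semigroup S]
    [AddCommGroup R] [Module k R] [AddCommGroup V] [Module k V]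
    (A : RBFData k S R) (D : ExtDatum k S R V) : R × V → R × V := fun p =>
  (A.theta p.1 + D.eta p.2, D.thetaV p.2)

/-- An extending datum is a Rota-Baxter family Hom extending structure when the
unified product `R ♮ V` is a Rota-Baxter family Hom-associative algebra of weight `lam`. -/
def IsExtendingStructure {k S R V : Type*} [Field k] [Semigroup S]
    [AddCommGroup R] [Module k R] [AddCommGroup V] [Module k V]
    (lam : k) (A : RBFData k S R) (D : ExtDatum k S R V) : Prop :=
  IsRBFOps lam (natMul A D) (natP A D) (natTheta A D)

/-- The projection `E → V = ker ρ`, `u ↦ u - ρ(u)`, associated to a linear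
retraction `ρ` of `E` onto the subspace `Rs`. -/
def projV {k E : Type*} [Field k] [AddCommGroup E] [Module k E]
    (Rs : Submodule k E) (ρ : E →ₗ[k] E)
    (hmem : ∀ u : E, ρ u ∈ Rs) (hid : ∀ a ∈ Rs, ρ a = a) (u : E) :
    ↥(LinearMap.ker ρ) :=
  ⟨u - ρ u, by
    have h := hid (ρ u) (hmem u)
    simp [LinearMap.mem_ker, map_sub, h]⟩

/-- `d : V → R` is a deformation map of the Rota-Baxter family Hom extending
structure `Ω(R,V) = Υ₁(E)` associated to the extension `R ⊆ E` and the retraction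
`ρ` (with `V = ker ρ`): writing the maps of `Υ₁(E)` via `ρ` (Eq. (3.3)), the three
deformation-map identities hold. -/
def IsDefMap {k S E : Type*} [Field k] [Semigroup S] [AddCommGroup E] [Module k E]
    (AE : RBFData k S E) (Rs : Submodule k E) (ρ : E →ₗ[k] E)
    (hmem : ∀ u : E, ρ u ∈ Rs) (hid : ∀ a ∈ Rs, ρ a = a)
    (d : ↥(LinearMap.ker ρ) →ₗ[k] ↥Rs) : Prop :=
  (∀ x y : ↥(LinearMap.ker ρ),
     AE.mul ↑(d x) ↑(d y) - (↑(d (projV Rs ρ hmem hid (AE.mul ↑x ↑y))) : E)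
       = (↑(d (projV Rs ρ hmem hid (AE.mul ↑(d x) ↑y)
             + projV Rs ρ hmem hid (AE.mul ↑x ↑(d y)))) : E)
         - ρ (AE.mul ↑(d x) ↑y) - ρ (AE.mul ↑x ↑(d y)) - ρ (AE.mul ↑x ↑y)) ∧
  (∀ (ω : S) (x : ↥(LinearMap.ker ρ)),
     (↑(d (projV Rs ρ hmem hid (AE.P ω ↑x))) : E)
       = ρ (AE.P ω ↑x) + AE.P ω ↑(d x)) ∧
  (∀ x : ↥(LinearMap.ker ρ),
     (↑(d (projV Rs ρ hmem hid (AE.theta ↑x))) : E)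
       = ρ (AE.theta ↑x) + AE.theta ↑(d x))

/-- The linear map `x ↦ -dt x` from `ker ρ` to `Rs`, for `dt` with values in `Rs`. -/
def negRestrict {k E : Type*} [Field k] [AddCommGroup E] [Module k E]
    (Rs : Submodule k E) (ρ dt : E →ₗ[k] E) (h : ∀ u, dt u ∈ Rs) :
    ↥(LinearMap.ker ρ) →ₗ[k] ↥Rs :=
  -(dt.codRestrict Rs h ∘ₗ (LinearMap.ker ρ).subtype)

theorem coe_negRestrict {k E : Type*} [Field k] [AddCommGroup E] [Module k E]
    (Rs : Submodule k E) (ρ dt : E →ₗ[k] E) (h : ∀ u, dt u ∈ Rs)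
    (x : ↥(LinearMap.ker ρ)) : (negRestrict Rs ρ dt h x : E) = -dt x := by
  simp [negRestrict]

/-- Theorem 4.3: let `R ⊆ E` be an extension of Rota-Baxter family Hom-associative
algebras with linear retraction `ρ`, `V := ker ρ`, and `Ω(R,V) := Υ₁(E)`. If `B` is
a Rota-Baxter family Hom complement of `R` in `E` with associated retraction `d̃`,
then `d := -d̃|_V : V → R` is a deformation map of `Ω(R,V)`, and
`φ : V_d → B, x ↦ x + d(x)` is an isomorphism of Rota-Baxter family Hom-associative
algebras; in particular `B ≅ V_d`. -/
theorem stmt14 {k S E : Type*} [Field k] [Semigroup S] [AddCommGroup E] [Module k E]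
    (lam : k) (AE : RBFData k S E) (hAE : AE.IsRBF lam)
    (Rs : Submodule k E)
    -- R is a subalgebra of E:
    (hRmul : ∀ a ∈ Rs, ∀ b ∈ Rs, AE.mul a b ∈ Rs)
    (hRP : ∀ (ω : S), ∀ a ∈ Rs, AE.P ω a ∈ Rs)
    (hRtheta : ∀ a ∈ Rs, AE.theta a ∈ Rs)
    -- ρ is a linear retraction of E onto R:
    (ρ : E →ₗ[k] E) (hmem : ∀ u : E, ρ u ∈ Rs) (hid : ∀ a ∈ Rs, ρ a = a)
    -- B is a Rota-Baxter family Hom complement of R in E: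
    (B : Submodule k E)
    (hBmul : ∀ a ∈ B, ∀ b ∈ B, AE.mul a b ∈ B)
    (hBP : ∀ (ω : S), ∀ a ∈ B, AE.P ω a ∈ B)
    (hBtheta : ∀ a ∈ B, AE.theta a ∈ B)
    (hsup : Rs ⊔ B = ⊤) (hinf : Rs ⊓ B = ⊥)
    -- d̃ is the retraction associated to B:
    (dt : E →ₗ[k] E) (hdt : ∀ a ∈ Rs, ∀ b ∈ B, dt (a + b) = a) :
    ∃ d : ↥(LinearMap.ker ρ) →ₗ[k] ↥Rs,
      -- d = -d̃|_V :
      (∀ x : ↥(LinearMap.ker ρ), (↑(d x) : E) = -(dt ↑x)) ∧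
      -- d is a deformation map of Ω(R,V) = Υ₁(E):
      IsDefMap AE Rs ρ hmem hid d ∧
      -- φ : V_d → B, x ↦ x + d(x), is an isomorphism of
      -- Rota-Baxter family Hom-associative algebras:
      Function.Injective (fun x : ↥(LinearMap.ker ρ) => (↑x + ↑(d x) : E)) ∧
      Set.range (fun x : ↥(LinearMap.ker ρ) => (↑x + ↑(d x) : E)) = (B : Set E) ∧
      (∀ x y : ↥(LinearMap.ker ρ),
        let m := projV Rs ρ hmem hid (AE.mul ↑x ↑y)
          + projV Rs ρ hmem hid (AE.mul ↑(d x) ↑y)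
          + projV Rs ρ hmem hid (AE.mul ↑x ↑(d y));
        (↑m + ↑(d m) : E) = AE.mul (↑x + ↑(d x)) (↑y + ↑(d y))) ∧
      (∀ (ω : S) (x : ↥(LinearMap.ker ρ)),
        let p := projV Rs ρ hmem hid (AE.P ω ↑x);
        (↑p + ↑(d p) : E) = AE.P ω (↑x + ↑(d x))) ∧
      (∀ x : ↥(LinearMap.ker ρ),
        let p := projV Rs ρ hmem hid (AE.theta ↑x);
        (↑p + ↑(d p) : E) = AE.theta (↑x + ↑(d x))) := by
  have hR : ∀ a ∈ Rs, dt a = a := fun a ha => by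
    simpa using hdt a ha 0 B.zero_mem
  have hB : ∀ b ∈ B, dt b = 0 := fun b hb => by
    simpa using hdt 0 Rs.zero_mem b hb
  have hsplit : ∀ u : E, dt u ∈ Rs ∧ u - dt u ∈ B := fun u => by
    obtain ⟨a, ha, b, hb, rfl⟩ := Submodule.mem_sup.1 (hsup ▸ Submodule.mem_top : u ∈ Rs ⊔ B)
    rw [hdt a ha b hb]
    exact ⟨ha, by simpa using hb⟩
  have hdtρ : ∀ u, dt (ρ u) = ρ u := fun u => hR _ (hmem u)
  let d := negRestrict Rs ρ dt fun u => (hsplit u).1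
  have hd : ∀ x : ↥(LinearMap.ker ρ), (d x : E) = -dt x := coe_negRestrict Rs ρ dt _
  have hdB : ∀ x : ↥(LinearMap.ker ρ), (x : E) + d x ∈ B := fun x => by
    rw [hd, ← sub_eq_add_neg]
    exact (hsplit x).2
  have hproj : ∀ u, (projV Rs ρ hmem hid u : E) = u - ρ u := fun u => rfl
  have hdproj : ∀ u, (d (projV Rs ρ hmem hid u) : E) = ρ u - dt u := fun u => by
    rw [hd, hproj, map_sub, hdtρ, neg_sub]
  have hmul : ∀ x y : ↥(LinearMap.ker ρ),
      AE.mul (d x) (d y) + dt (AE.mul x y) + dt (AE.mul (d x) y) + dt (AE.mul x (d y)) = 0 :=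
    fun x y => by
      have h := hB _ (hBmul _ (hdB x) _ (hdB y))
      simp only [map_add, LinearMap.add_apply] at h
      rw [hR _ (hRmul _ (d x).2 _ (d y).2)] at h
      rw [← h]
      abel
  have hP : ∀ (ω : S) (x : ↥(LinearMap.ker ρ)), AE.P ω (d x) = -dt (AE.P ω x) := fun ω x => by
    have h := hB _ (hBP ω _ (hdB x))
    rw [map_add, map_add, hR _ (hRP ω _ (d x).2)] at h
    exact eq_neg_of_add_eq_zero_right h
  have htheta : ∀ x : ↥(LinearMap.ker ρ), AE.theta (d x) = -dt (AE.theta x) := fun x => by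
    have h := hB _ (hBtheta _ (hdB x))
    rw [map_add, map_add, hR _ (hRtheta _ (d x).2)] at h
    exact eq_neg_of_add_eq_zero_right h
  refine ⟨d, hd, ⟨fun x y => ?_, fun ω x => ?_, fun x => ?_⟩, fun x y hxy => ?_, ?_,
    fun x y => ?_, fun ω x => ?_, fun x => ?_⟩
  · rw [map_add, Submodule.coe_add, hdproj, hdproj, hdproj, ← sub_eq_zero, ← hmul x y]
    abel
  · rw [hdproj, hP, sub_eq_add_neg]
  · rw [hdproj, htheta, sub_eq_add_neg]
  · have h := congrArg ρ hxy
    simp only [map_add, LinearMap.mem_ker.1 x.2, LinearMap.mem_ker.1 y.2, zero_add,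
      hid _ (d x).2, hid _ (d y).2] at h
    simp only [h] at hxy
    exact Subtype.ext (add_right_cancel hxy)
  · ext b
    constructor
    · rintro ⟨x, rfl⟩
      exact hdB x
    · intro hb
      refine ⟨projV Rs ρ hmem hid b, ?_⟩
      simp only [hdproj, hproj, hB b hb]
      abel
  · simp only [map_add, Submodule.coe_add, hdproj, hproj, LinearMap.add_apply]
    rw [eq_neg_of_add_eq_zero_left
      (by rw [← hmul x y]; abel :
        AE.mul (d x) (d y) + (dt (AE.mul x y) + dt (AE.mul (d x) y) + dt (AE.mul x (d y))) = 0)]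
    abel
  · simp only [map_add, hdproj, hproj, hP]
    abel
  · simp only [map_add, hdproj, hproj, htheta]
    abel
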